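/- If 0 < ε < 1/8 and |η| ≤ 1/2, then the tail products converge to 1: lim_{N→∞} ∏_{n=N}^∞ (1 + α_n η_n'(η)) = 1; in particular α_n η_n'(η) → 0 as n → ∞. -/

import Mathlib

open Filter Topology

/-- `ε₀ = 0`, `εₙ = ε^(2^n)` for `n ≥ 1`. -/
noncomputable def epsSeq (ε : ℝ) (n : ℕ) : ℝ := if n = 0 then 0 else ε ^ (2 ^ n)

/-- `αₙ = 1 + εₙ`. -/
noncomputable def alphaSeq (ε : ℝ) (n : ℕ) : ℝ := 1 + epsSeq ε n

/-- `η₀'(η) = η`, `η_{n+1}'(η) = αₙ² ηₙ'(η)² − ε_{n+1}/α_{n+1}`. -/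
noncomputable def etaP (ε : ℝ) : ℕ → ℝ → ℝ
  | 0 => fun η => η
  | n + 1 => fun η =>
      alphaSeq ε n ^ 2 * (etaP ε n η) ^ 2 - epsSeq ε (n + 1) / alphaSeq ε (n + 1)

lemma norm_tprod_one_add_sub_one_le {ι : Type*} {f : ι → ℝ} (hf : Summable fun i => ‖f i‖) :
    ‖∏' i, (1 + f i) - 1‖ ≤ Real.exp (∑' i, ‖f i‖) - 1 := by
  have hprod := (multipliable_one_add_of_summable hf).hasProd
  refine le_of_tendsto (hprod.sub_const 1).norm (Eventually.of_forall fun t => ?_)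
  refine (t.norm_prod_one_add_sub_one_le f).trans ?_
  gcongr
  exact hf.sum_le_tsum t fun i _ => norm_nonneg _

lemma tendsto_tprod_one_add_nat_add {f : ℕ → ℝ} (hf : Summable fun n => ‖f n‖) :
    Tendsto (fun N : ℕ => ∏' n : ℕ, (1 + f (N + n))) atTop (𝓝 1) := by
  rw [tendsto_iff_norm_sub_tendsto_zero]
  have htail : Tendsto (fun N : ℕ => ∑' n : ℕ, ‖f (N + n)‖) atTop (𝓝 0) := by
    simpa only [add_comm] using tendsto_sum_nat_add fun n => ‖f n‖
  have hexp : Tendsto (fun N : ℕ => Real.exp (∑' n : ℕ, ‖f (N + n)‖) - 1) atTop (𝓝 0) := by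
    simpa using ((Real.continuous_exp.tendsto 0).comp htail).sub_const 1
  refine squeeze_zero (fun _ => norm_nonneg _) (fun N => ?_) hexp
  refine norm_tprod_one_add_sub_one_le (f := fun n => f (N + n)) ?_
  simpa only [add_comm] using (summable_nat_add_iff N).2 hf

lemma epsSeq_nonneg {ε : ℝ} (hε : 0 ≤ ε) (n : ℕ) : 0 ≤ epsSeq ε n := by
  unfold epsSeq
  split_ifs <;> positivity

lemma epsSeq_le_half_pow {ε : ℝ} (hε : 0 ≤ ε) (hε2 : ε ≤ 1 / 2) (n : ℕ) :
    epsSeq ε n ≤ (1 / 2) ^ (n + 1) := by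
  unfold epsSeq
  split_ifs
  · positivity
  · calc ε ^ 2 ^ n ≤ (1 / 2) ^ 2 ^ n := by gcongr
      _ ≤ (1 / 2) ^ (n + 1) :=
        pow_le_pow_of_le_one (by norm_num) (by norm_num) (Nat.lt_two_pow_self)

/-- The scaled sequence `xₙ = αₙ ηₙ'` satisfies `xₙ₊₁ = αₙ₊₁ xₙ² - εₙ₊₁`. -/
lemma alphaSeq_mul_etaP_succ {ε : ℝ} (hε : 0 ≤ ε) (n : ℕ) (η : ℝ) :
    alphaSeq ε (n + 1) * etaP ε (n + 1) η =
      alphaSeq ε (n + 1) * (alphaSeq ε n * etaP ε n η) ^ 2 - epsSeq ε (n + 1) := by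
  have hα : alphaSeq ε (n + 1) ≠ 0 := by
    have := epsSeq_nonneg hε (n + 1)
    unfold alphaSeq
    positivity
  rw [etaP]
  field_simp

lemma abs_alphaSeq_mul_etaP_le {ε : ℝ} (hε : 0 ≤ ε) (hε2 : ε ≤ 1 / 2) {η : ℝ}
    (hη : |η| ≤ 1 / 2) (n : ℕ) : |alphaSeq ε n * etaP ε n η| ≤ (1 / 2) ^ (n + 1) := by
  induction n with
  | zero => simpa [alphaSeq, epsSeq, etaP] using hη
  | succ n ih =>
    rw [alphaSeq_mul_etaP_succ hε, alphaSeq]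
    set x := alphaSeq ε n * etaP ε n η
    have he := epsSeq_nonneg hε (n + 1)
    have hle := epsSeq_le_half_pow hε hε2 (n + 1)
    have hhalf : ((1 : ℝ) / 2) ^ (n + 1) ≤ 1 / 2 :=
      pow_le_of_le_one (by norm_num) (by norm_num) n.succ_ne_zero
    have hsq : x ^ 2 ≤ (1 / 2) ^ (n + 1 + 1) := by
      rw [← sq_abs, pow_succ _ (n + 1), sq]
      exact mul_le_mul ih (ih.trans hhalf) (abs_nonneg x) (by positivity)
    have hsq_one : x ^ 2 ≤ 1 := hsq.trans (pow_le_one₀ (by norm_num) (by norm_num))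
    rw [abs_le]
    constructor <;> nlinarith [mul_nonneg he (sq_nonneg x), mul_nonneg he (sub_nonneg.2 hsq_one)]

/-- For `0 < ε < 1/8` and `|η| ≤ 1/2`, the tail products `∏_{n=N}^∞ (1 + αₙ ηₙ'(η))` tend to
`1` as `N → ∞`; in particular `αₙ ηₙ'(η) → 0`. -/
theorem stmt_7 (ε : ℝ) (hε : 0 < ε) (hε8 : ε < 1 / 8) (η : ℝ) (hη : |η| ≤ 1 / 2) :
    Tendsto (fun N : ℕ => ∏' n : ℕ, (1 + alphaSeq ε (N + n) * etaP ε (N + n) η))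
      atTop (𝓝 1) ∧
    Tendsto (fun n : ℕ => alphaSeq ε n * etaP ε n η) atTop (𝓝 0) := by
  have hbound := abs_alphaSeq_mul_etaP_le hε.le (by linarith : ε ≤ 1 / 2) hη
  have hgeom : Summable fun n : ℕ => ((1 : ℝ) / 2) ^ (n + 1) :=
    (summable_nat_add_iff 1).2 summable_geometric_two
  have hsum : Summable fun n : ℕ => ‖alphaSeq ε n * etaP ε n η‖ :=
    hgeom.of_nonneg_of_le (fun _ => norm_nonneg _) hbound
  exact ⟨tendsto_tprod_one_add_nat_add hsum, hsum.of_norm.tendsto_atTop_zero⟩
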